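/- arXiv:2207.01303 — 2 statements merged into one kernel-verified Lean document; each statement's English description precedes it below -/
import Mathlib

section
/- Let g : [0,∞) → 𝕂ⁿ be locally Lebesgue integrable and define x : [-r,∞) → 𝕂ⁿ by x = 0 on [-r,0) and x(t) = ∫_0^t X^L(t-u) g(u) du for t ≥ 0. Then x is continuous on [0,∞) and x(t) = L(∫_0^t x_s ds) + ∫_0^t g(u) du for all t ≥ 0; that is, x is the unique solution with zero initial datum of the integral equation with forcing term Vg. -/
open MeasureTheory

/-- `X` is the principal fundamental matrix solution of `ẋ(t) = L x_t`:
`X = O` on `[-r,0)`, `X` continuous on `[0,∞)`, `X(0) = I`, and for every `ξ` and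
`t ≥ 0`, `X(t)ξ = ξ + L(θ ↦ ∫_0^{max(t+θ,0)} X(s)ξ ds)`. -/
def IsPFMS {𝕜 : Type*} [RCLike 𝕜] {n : ℕ} (r : ℝ)
    (L : C(Set.Icc (-r) (0:ℝ), Fin n → 𝕜) →L[𝕜] (Fin n → 𝕜))
    (X : ℝ → ((Fin n → 𝕜) →L[𝕜] (Fin n → 𝕜))) : Prop :=
  (∀ t ∈ Set.Ico (-r) (0:ℝ), X t = 0) ∧
  ContinuousOn X (Set.Ici (0:ℝ)) ∧ X 0 = 1 ∧
  ∀ ξ : Fin n → 𝕜, ∀ t, 0 ≤ t → ∃ ψ : C(Set.Icc (-r) (0:ℝ), Fin n → 𝕜),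
    (∀ θ : Set.Icc (-r) (0:ℝ), ψ θ = ∫ s in (0:ℝ)..(max (t + (θ : ℝ)) 0), X s ξ) ∧
    X t ξ = ξ + L ψ

/-- `IsSolForced r L φ ξ G x` : `x` solves `x(t) = ξ + L(∫_0^t x_s ds) + G(t)` for
`t ≥ 0`, with history `φ` on `[-r,0)` and value `ξ` at `0`. -/
def IsSolForced {𝕜 : Type*} [RCLike 𝕜] {n : ℕ} (r : ℝ)
    (L : C(Set.Icc (-r) (0:ℝ), Fin n → 𝕜) →L[𝕜] (Fin n → 𝕜))
    (φ : ℝ → Fin n → 𝕜) (ξ : Fin n → 𝕜) (G : ℝ → Fin n → 𝕜)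
    (x : ℝ → Fin n → 𝕜) : Prop :=
  (∀ θ ∈ Set.Ico (-r) (0:ℝ), x θ = φ θ) ∧ x 0 = ξ ∧
  ContinuousOn x (Set.Ici (0:ℝ)) ∧
  ∀ t, 0 ≤ t → ∃ ψ : C(Set.Icc (-r) (0:ℝ), Fin n → 𝕜),
    (∀ θ : Set.Icc (-r) (0:ℝ), ψ θ = ∫ s in (θ : ℝ)..(t + (θ : ℝ)), x s) ∧
    x t = ξ + L ψ + G t

open Set Filter Topology

section CausalPart

variable {F : Type*} [NormedAddCommGroup F] {f : ℝ → F}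

lemma stronglyMeasurable_indicator_Ici_zero (hf : ContinuousOn f (Ici 0)) :
    StronglyMeasurable ((Ici (0 : ℝ)).indicator f) := by
  have hc : Continuous fun t : ℝ => f (max t 0) :=
    hf.comp_continuous (by fun_prop) fun t => le_max_right t 0
  have h : (Ici (0 : ℝ)).indicator f = (Ici (0 : ℝ)).indicator fun t => f (max t 0) := by
    refine indicator_congr fun t ht => ?_
    rw [max_eq_left (mem_Ici.1 ht)]
  rw [h]
  exact hc.stronglyMeasurable.indicator measurableSet_Ici

lemma exists_norm_indicator_Ici_zero_le (hf : ContinuousOn f (Ici 0)) (T : ℝ) :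
    ∃ M, ∀ t ≤ T, ‖(Ici (0 : ℝ)).indicator f t‖ ≤ M := by
  obtain ⟨M, hM⟩ := isCompact_Icc.exists_bound_of_continuousOn
    (hf.mono (Icc_subset_Ici_self : Icc (0 : ℝ) T ⊆ Ici 0))
  refine ⟨max M 0, fun t ht => ?_⟩
  by_cases h0 : 0 ≤ t
  · rw [indicator_of_mem (mem_Ici.2 h0)]
    exact (hM t ⟨h0, ht⟩).trans (le_max_left _ _)
  · rw [indicator_of_notMem (by simpa using h0), norm_zero]
    exact le_max_right _ _

lemma intervalIntegrable_indicator_Ici_zero (hf : ContinuousOn f (Ici 0)) (a b : ℝ) :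
    IntervalIntegrable ((Ici (0 : ℝ)).indicator f) volume a b := by
  obtain ⟨M, hM⟩ := exists_norm_indicator_Ici_zero_le hf (max a b)
  refine (intervalIntegrable_const (c := M)).mono_fun
    (stronglyMeasurable_indicator_Ici_zero hf).aestronglyMeasurable ?_
  filter_upwards [ae_restrict_mem measurableSet_uIoc] with t ht
  exact (hM t ht.2).trans (le_abs_self M)

lemma continuousAt_indicator_Ici_zero (hf : ContinuousOn f (Ici 0)) {t : ℝ} (ht : t ≠ 0) :
    ContinuousAt ((Ici (0 : ℝ)).indicator f) t := by
  rcases lt_or_gt_of_ne ht with h | h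
  · refine (continuousAt_const (y := (0 : F))).congr ?_
    filter_upwards [Iio_mem_nhds h] with s hs
    rw [indicator_of_notMem (by simpa using hs)]
  · refine (hf.continuousAt (Ici_mem_nhds h)).congr ?_
    filter_upwards [Ioi_mem_nhds h] with s hs
    rw [indicator_of_mem (mem_Ici.2 (le_of_lt hs))]

variable [NormedSpace ℝ F]

lemma integral_indicator_Ici_zero_of_nonpos {a b : ℝ} (ha : a ≤ 0) (hb : b ≤ 0) :
    ∫ s in a..b, (Ici (0 : ℝ)).indicator f s = 0 := by
  refine intervalIntegral.integral_zero_ae ?_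
  filter_upwards [Measure.ae_ne volume (0 : ℝ)] with s hs0 hs
  have : s ≤ 0 := hs.2.trans (max_le ha hb)
  exact indicator_of_notMem (by simpa using lt_of_le_of_ne this hs0) f

/-- The causal part does not see the part of the interval to the left of `0`. -/
lemma integral_indicator_Ici_zero_of_le (hf : ContinuousOn f (Ici 0)) {a : ℝ} (ha : a ≤ 0)
    (b : ℝ) :
    ∫ s in a..b, (Ici (0 : ℝ)).indicator f s = ∫ s in (0 : ℝ)..b, (Ici (0 : ℝ)).indicator f s := by
  rw [← intervalIntegral.integral_add_adjacent_intervals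
    (intervalIntegrable_indicator_Ici_zero hf a 0) (intervalIntegrable_indicator_Ici_zero hf 0 b),
    integral_indicator_Ici_zero_of_nonpos ha le_rfl, zero_add]

lemma integral_indicator_Ici_zero_eq_max (b : ℝ) :
    ∫ s in (0 : ℝ)..b, (Ici (0 : ℝ)).indicator f s = ∫ s in (0 : ℝ)..max b 0, f s := by
  rcases le_total 0 b with h | h
  · rw [max_eq_left h]
    refine intervalIntegral.integral_congr fun s hs => ?_
    rw [uIcc_of_le h] at hs
    exact indicator_of_mem (mem_Ici.2 hs.1) f
  · rw [max_eq_right h, intervalIntegral.integral_same,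
      integral_indicator_Ici_zero_of_nonpos le_rfl h]

end CausalPart

section Convolution

variable {𝕜 : Type*} [RCLike 𝕜] {n : ℕ} {X : ℝ → ((Fin n → 𝕜) →L[𝕜] (Fin n → 𝕜))}
  {g : ℝ → Fin n → 𝕜}

lemma aestronglyMeasurable_clm_apply {α : Type*} [MeasurableSpace α] {μ : Measure α}
    {A : α → ((Fin n → 𝕜) →L[𝕜] (Fin n → 𝕜))} {v : α → Fin n → 𝕜}
    (hA : AEStronglyMeasurable A μ) (hv : AEStronglyMeasurable v μ) :
    AEStronglyMeasurable (fun a => A a (v a)) μ :=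
  Continuous.comp_aestronglyMeasurable₂
    (g := fun (B : (Fin n → 𝕜) →L[𝕜] (Fin n → 𝕜)) (w : Fin n → 𝕜) => B w)
    isBoundedBilinearMap_apply.continuous hA hv

lemma intervalIntegrable_convolution_causal (hX : ContinuousOn X (Ici 0)) {T : ℝ} (hT : 0 ≤ T)
    (hg : IntervalIntegrable g volume 0 T) (s : ℝ) :
    IntervalIntegrable (fun u => (Ici (0 : ℝ)).indicator X (s - u) (g u)) volume 0 T := by
  obtain ⟨M, hM⟩ := exists_norm_indicator_Ici_zero_le hX s
  refine (hg.norm.const_mul M).mono_fun (aestronglyMeasurable_clm_apply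
    ((stronglyMeasurable_indicator_Ici_zero hX).comp_measurable
      (measurable_const.sub measurable_id)).aestronglyMeasurable hg.def'.aestronglyMeasurable) ?_
  filter_upwards [ae_restrict_mem measurableSet_uIoc] with u hu
  rw [uIoc_of_le hT] at hu
  refine le_trans ?_ (le_abs_self _)
  exact ContinuousLinearMap.le_of_opNorm_le _ (hM _ (by linarith [hu.1])) _

lemma continuous_convolution_causal (hX : ContinuousOn X (Ici 0)) {T : ℝ} (hT : 0 ≤ T)
    (hg : IntervalIntegrable g volume 0 T) :
    Continuous fun s => ∫ u in (0 : ℝ)..T, (Ici (0 : ℝ)).indicator X (s - u) (g u) := by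
  refine continuous_iff_continuousAt.2 fun s₀ => ?_
  obtain ⟨M, hM⟩ := exists_norm_indicator_Ici_zero_le hX (s₀ + 1)
  refine intervalIntegral.continuousAt_of_dominated_interval (bound := fun u => M * ‖g u‖)
    (Eventually.of_forall fun s =>
      (intervalIntegrable_convolution_causal hX hT hg s).def'.aestronglyMeasurable) ?_
    (hg.norm.const_mul M) ?_
  · filter_upwards [Iio_mem_nhds (lt_add_one s₀)] with s hs
    refine Eventually.of_forall fun u hu => ?_
    rw [uIoc_of_le hT] at hu
    rw [mem_Iio] at hs
    exact ContinuousLinearMap.le_of_opNorm_le _ (hM _ (by linarith [hu.1])) _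
  · filter_upwards [Measure.ae_ne volume s₀] with u hu _
    have h : ContinuousAt (fun s => (Ici (0 : ℝ)).indicator X (s - u)) s₀ :=
      ContinuousAt.comp' (g := (Ici (0 : ℝ)).indicator X)
        (continuousAt_indicator_Ici_zero hX (sub_ne_zero.2 hu.symm)) (by fun_prop)
    exact h.clm_apply continuousAt_const

lemma convolution_causal_of_neg {T s : ℝ} (hT : 0 ≤ T) (hs : s < 0) :
    ∫ u in (0 : ℝ)..T, (Ici (0 : ℝ)).indicator X (s - u) (g u) = 0 := by
  refine intervalIntegral.integral_zero_ae (Eventually.of_forall fun u hu => ?_)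
  rw [uIoc_of_le hT] at hu
  have h : s - u ∉ Ici (0 : ℝ) := by
    rw [mem_Ici, not_le]
    linarith [hu.1]
  simp [indicator_of_notMem h]

lemma convolution_causal_of_mem_Icc (hX : ContinuousOn X (Ici 0)) {T s : ℝ}
    (hg : IntervalIntegrable g volume 0 T) (hs : s ∈ Icc 0 T) :
    ∫ u in (0 : ℝ)..T, (Ici (0 : ℝ)).indicator X (s - u) (g u) =
      ∫ u in (0 : ℝ)..s, X (s - u) (g u) := by
  have hI := intervalIntegrable_convolution_causal hX (hs.1.trans hs.2) hg s
  have hs' : s ∈ uIcc 0 T := by rwa [uIcc_of_le (hs.1.trans hs.2)]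
  rw [← intervalIntegral.integral_add_adjacent_intervals
    (hI.mono_set (uIcc_subset_uIcc_left hs')) (hI.mono_set (uIcc_subset_uIcc_right hs'))]
  have hzero : ∫ u in s..T, (Ici (0 : ℝ)).indicator X (s - u) (g u) = 0 := by
    refine intervalIntegral.integral_zero_ae (Eventually.of_forall fun u hu => ?_)
    rw [uIoc_of_le hs.2] at hu
    have h : s - u ∉ Ici (0 : ℝ) := by
      rw [mem_Ici, not_le]
      linarith [hu.1]
    simp [indicator_of_notMem h]
  rw [hzero, add_zero]
  refine intervalIntegral.integral_congr fun u hu => ?_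
  rw [uIcc_of_le hs.1] at hu
  have h : s - u ∈ Ici (0 : ℝ) := sub_nonneg.2 hu.2
  simp only [indicator_of_mem h]

/-- Integrating the causal convolution amounts to convolving with the primitive of the kernel. -/
lemma integral_convolution_causal (hX : ContinuousOn X (Ici 0)) {T : ℝ} (hT : 0 ≤ T)
    (hg : IntervalIntegrable g volume 0 T) {a : ℝ} (ha : a ≤ 0) (b : ℝ) :
    ∫ s in a..b, ∫ u in (0 : ℝ)..T, (Ici (0 : ℝ)).indicator X (s - u) (g u) =
      ∫ u in (0 : ℝ)..T, (∫ s in (0 : ℝ)..(b - u), (Ici (0 : ℝ)).indicator X s) (g u) := by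
  obtain ⟨M, hM⟩ := exists_norm_indicator_Ici_zero_le hX (max a b)
  have hint : Integrable
      (Function.uncurry fun s u => (Ici (0 : ℝ)).indicator X (s - u) (g u))
      ((volume.restrict (uIoc a b)).prod (volume.restrict (uIoc 0 T))) := by
    have hg' : Integrable g (volume.restrict (uIoc 0 T)) := hg.def'
    have : IsFiniteMeasure (volume.restrict (uIoc a b)) :=
      Real.isFiniteMeasure_restrict_Ioc (min a b) (max a b)
    refine ((hg'.norm.comp_snd (volume.restrict (uIoc a b))).const_mul M).mono
      (aestronglyMeasurable_clm_apply ((stronglyMeasurable_indicator_Ici_zero hX).comp_measurable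
        (measurable_fst.sub measurable_snd)).aestronglyMeasurable
        (hg'.aestronglyMeasurable.comp_snd)) ?_
    rw [Measure.prod_restrict]
    filter_upwards [ae_restrict_mem (measurableSet_uIoc.prod measurableSet_uIoc)] with p hp
    refine le_trans ?_ (le_abs_self _)
    have h1 : p.1 ≤ max a b := hp.1.2
    have h2 : 0 < p.2 := by
      have := hp.2
      rw [uIoc_of_le hT] at this
      exact this.1
    exact ContinuousLinearMap.le_of_opNorm_le _ (hM _ (by linarith)) _
  rw [intervalIntegral_intervalIntegral_swap
    (by rwa [Measure.prod_restrict, ← Measure.volume_eq_prod] at hint)]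
  refine intervalIntegral.integral_congr fun u hu => ?_
  rw [uIcc_of_le hT] at hu
  have h := integral_indicator_Ici_zero_of_le hX (show a - u ≤ 0 by linarith [hu.1]) (b - u)
  rw [intervalIntegral.integral_comp_sub_right
    (fun s => (Ici (0 : ℝ)).indicator X s (g u)) u, ← h,
    ContinuousLinearMap.intervalIntegral_apply (intervalIntegrable_indicator_Ici_zero hX _ _)]

end Convolution

section Uniqueness

/-- Grönwall's lemma in integral form with zero initial value. -/
lemma eq_zero_of_le_mul_integral {N : ℝ → ℝ} (hN : Continuous N) (hN0 : ∀ t, 0 ≤ N t) {K : ℝ}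
    (h : ∀ t, 0 ≤ t → N t ≤ K * ∫ s in (0 : ℝ)..t, N s) {t : ℝ} (ht : 0 ≤ t) : N t = 0 := by
  have hder : ∀ s, HasDerivAt (fun s => ∫ u in (0 : ℝ)..s, N u) (N s) s := fun s =>
    intervalIntegral.integral_hasDerivAt_right (hN.intervalIntegrable _ _)
      (hN.stronglyMeasurableAtFilter _ _) hN.continuousAt
  have hzero := eq_zero_of_abs_deriv_le_mul_abs_self_of_eq_zero_right
    (f := fun s => ∫ u in (0 : ℝ)..s, N u) (f' := N) (K := K) (a := 0) (b := t)
    (fun s _ => (hder s).continuousAt.continuousWithinAt) (fun s _ => (hder s).hasDerivWithinAt)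
    intervalIntegral.integral_same (fun s hs => by
      rw [Real.norm_of_nonneg (hN0 s), Real.norm_of_nonneg
        (intervalIntegral.integral_nonneg hs.1 fun u _ => hN0 u)]
      exact h s hs.1) t ⟨ht, le_rfl⟩
  have := h t ht
  rw [hzero, mul_zero] at this
  exact le_antisymm this (hN0 t)

variable {𝕜 : Type*} [RCLike 𝕜] {n : ℕ} {r : ℝ}
  {L : C(Icc (-r) (0 : ℝ), Fin n → 𝕜) →L[𝕜] (Fin n → 𝕜)}

lemma integral_history_eq_indicator {x : ℝ → Fin n → 𝕜} (hx : ∀ t ∈ Ico (-r) (0 : ℝ), x t = 0)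
    {a b : ℝ} (ha : -r ≤ a) (hab : a ≤ b) :
    ∫ s in a..b, x s = ∫ s in a..b, (Ici (0 : ℝ)).indicator x s := by
  refine intervalIntegral.integral_congr fun s hs => ?_
  rw [uIcc_of_le hab] at hs
  by_cases h : 0 ≤ s
  · exact (indicator_of_mem (mem_Ici.2 h) x).symm
  · rw [indicator_of_notMem (by simpa using h), hx s ⟨ha.trans hs.1, not_le.1 h⟩]

/-- Solutions with zero initial history are determined by their initial value and forcing. -/
lemma IsSolForced.eq_of_zero_history {ξ : Fin n → 𝕜} {G x y : ℝ → Fin n → 𝕜}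
    (hx : IsSolForced r L (fun _ => 0) ξ G x) (hy : IsSolForced r L (fun _ => 0) ξ G y) {t : ℝ}
    (ht : 0 ≤ t) : y t = x t := by
  obtain ⟨hx0, -, hxc, hx⟩ := hx
  obtain ⟨hy0, -, hyc, hy⟩ := hy
  have hdc : ContinuousOn (fun t => y t - x t) (Ici 0) := hyc.sub hxc
  have hNc : Continuous fun t : ℝ => ‖y (max t 0) - x (max t 0)‖ :=
    (hdc.comp_continuous (f := fun t : ℝ => max t 0) (by fun_prop)
      fun t => le_max_right t 0).norm
  have key : ∀ t, 0 ≤ t → ‖y (max t 0) - x (max t 0)‖ ≤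
      ‖L‖ * ∫ s in (0 : ℝ)..t, ‖y (max s 0) - x (max s 0)‖ := by
    intro t ht
    obtain ⟨ψ, hψ, hψt⟩ := hx t ht
    obtain ⟨χ, hχ, hχt⟩ := hy t ht
    have hI : 0 ≤ ∫ s in (0 : ℝ)..t, ‖y (max s 0) - x (max s 0)‖ :=
      intervalIntegral.integral_nonneg ht fun _ _ => norm_nonneg _
    rw [max_eq_left ht, hψt, hχt, add_sub_add_right_eq_sub, add_sub_add_left_eq_sub, ← map_sub]
    refine L.le_opNorm_of_le ((ContinuousMap.norm_le _ hI).2 fun θ => ?_)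
    have hθ := θ.2
    have hθt : (θ : ℝ) ≤ t + θ := by linarith
    rw [ContinuousMap.sub_apply, hψ, hχ, integral_history_eq_indicator hx0 hθ.1 hθt,
      integral_history_eq_indicator hy0 hθ.1 hθt,
      ← intervalIntegral.integral_sub (intervalIntegrable_indicator_Ici_zero hyc _ _)
        (intervalIntegrable_indicator_Ici_zero hxc _ _)]
    have hsub : (fun s => (Ici (0 : ℝ)).indicator y s - (Ici (0 : ℝ)).indicator x s) =
        (Ici (0 : ℝ)).indicator fun s => y s - x s := (indicator_sub _ y x).symm
    rw [hsub, integral_indicator_Ici_zero_of_le hdc hθ.2, integral_indicator_Ici_zero_eq_max]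
    have hm : max (t + θ) 0 ≤ t := max_le (by linarith [hθ.2]) ht
    refine (intervalIntegral.norm_integral_le_integral_norm (le_max_right _ _)).trans ?_
    have hcongr : ∫ s in (0 : ℝ)..max (t + θ) 0, ‖y s - x s‖ =
        ∫ s in (0 : ℝ)..max (t + θ) 0, ‖y (max s 0) - x (max s 0)‖ := by
      refine intervalIntegral.integral_congr fun s hs => ?_
      rw [uIcc_of_le (le_max_right _ _)] at hs
      simp only [max_eq_left hs.1]
    rw [hcongr]
    exact intervalIntegral.integral_mono_interval le_rfl (le_max_right _ _) hm
      (Eventually.of_forall fun _ => norm_nonneg _) (hNc.intervalIntegrable _ _)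
  have := eq_zero_of_le_mul_integral hNc (fun _ => norm_nonneg _) key ht
  rwa [max_eq_left ht, norm_eq_zero, sub_eq_zero] at this

end Uniqueness

section Existence

variable {𝕜 : Type*} [RCLike 𝕜] {n : ℕ} {r : ℝ}
  {L : C(Icc (-r) (0 : ℝ), Fin n → 𝕜) →L[𝕜] (Fin n → 𝕜)}
  {X : ℝ → ((Fin n → 𝕜) →L[𝕜] (Fin n → 𝕜))}

lemma continuous_primitive_causal (hX : ContinuousOn X (Ici 0)) :
    Continuous fun t : ℝ => ∫ s in (0 : ℝ)..t, (Ici (0 : ℝ)).indicator X s :=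
  intervalIntegral.continuous_primitive (intervalIntegrable_indicator_Ici_zero hX) 0

/-- `(t, ξ) ↦ (θ ↦ (∫_0^{t+θ} X(s) ds) ξ)`, with `X` extended by zero to the left of `0`. -/
noncomputable def primitiveSegment (r : ℝ) (hX : ContinuousOn X (Ici 0)) :
    C(ℝ × (Fin n → 𝕜), C(Icc (-r) (0 : ℝ), Fin n → 𝕜)) :=
  ContinuousMap.curry
    ⟨fun p => (∫ s in (0 : ℝ)..(p.1.1 + (p.2 : ℝ)), (Ici (0 : ℝ)).indicator X s) p.1.2, by
      have h := (continuous_primitive_causal hX).comp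
        (f := fun p : (ℝ × (Fin n → 𝕜)) × Icc (-r) (0 : ℝ) => p.1.1 + (p.2 : ℝ)) (by fun_prop)
      exact h.clm_apply (by fun_prop)⟩

lemma primitiveSegment_apply (hX : ContinuousOn X (Ici 0)) (t : ℝ) (ξ : Fin n → 𝕜)
    (θ : Icc (-r) (0 : ℝ)) :
    primitiveSegment r hX (t, ξ) θ =
      (∫ s in (0 : ℝ)..(t + (θ : ℝ)), (Ici (0 : ℝ)).indicator X s) ξ :=
  rfl

lemma IsPFMS.apply_eq (hX : IsPFMS r L X) {t : ℝ} (ht : 0 ≤ t) (ξ : Fin n → 𝕜) :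
    X t ξ = ξ + L (primitiveSegment r hX.2.1 (t, ξ)) := by
  obtain ⟨ψ, hψ, h⟩ := hX.2.2.2 ξ t ht
  rw [h]
  congr 2
  ext1 θ
  have hint : IntervalIntegrable X volume 0 (max (t + θ) 0) :=
    (hX.2.1.mono (by
      rw [uIcc_of_le (le_max_right _ _)]
      exact Icc_subset_Ici_self)).intervalIntegrable
  rw [hψ, primitiveSegment_apply, integral_indicator_Ici_zero_eq_max,
    ContinuousLinearMap.intervalIntegral_apply hint]

lemma intervalIntegrable_primitiveSegment (hX : ContinuousOn X (Ici 0)) {g : ℝ → Fin n → 𝕜}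
    {t : ℝ} (hg : IntervalIntegrable g volume 0 t) :
    IntervalIntegrable (fun u => primitiveSegment r hX (t - u, g u)) volume 0 t := by
  obtain ⟨M, hM⟩ := (isCompact_uIcc (a := (0 : ℝ)) (b := t)).prod
    (isCompact_Icc (a := -r) (b := (0 : ℝ))) |>.exists_bound_of_continuousOn
    (f := fun p : ℝ × ℝ => ∫ s in (0 : ℝ)..(t - p.1 + p.2), (Ici (0 : ℝ)).indicator X s)
    ((continuous_primitive_causal hX).comp (by fun_prop)).continuousOn
  refine (hg.norm.const_mul |M|).mono_fun
    ((primitiveSegment r hX).continuous.comp_aestronglyMeasurable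
      ((by fun_prop : Continuous fun u : ℝ => t - u).aestronglyMeasurable.prodMk
        hg.def'.aestronglyMeasurable)) ?_
  filter_upwards [ae_restrict_mem measurableSet_uIoc] with u hu
  refine le_trans ?_ (le_abs_self _)
  refine (ContinuousMap.norm_le _ (by positivity)).2 fun θ => ?_
  rw [primitiveSegment_apply]
  exact ContinuousLinearMap.le_of_opNorm_le _
    ((hM (u, θ) ⟨uIoc_subset_uIcc hu, θ.2⟩).trans (le_abs_self M)) _

/-- The variation of constants formula. -/
lemma IsPFMS.isSolForced_convolution (hX : IsPFMS r L X) {g x : ℝ → Fin n → 𝕜}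
    (hg : ∀ T, 0 ≤ T → IntervalIntegrable g volume 0 T)
    (hxneg : ∀ t ∈ Ico (-r) (0 : ℝ), x t = 0)
    (hxpos : ∀ t, 0 ≤ t → x t = ∫ u in (0 : ℝ)..t, X (t - u) (g u)) :
    IsSolForced r L (fun _ => 0) 0 (fun t => ∫ u in (0 : ℝ)..t, g u) x := by
  have hXc := hX.2.1
  have hxT : ∀ T, 0 ≤ T → ∀ s ∈ Icc (-r) T,
      x s = ∫ u in (0 : ℝ)..T, (Ici (0 : ℝ)).indicator X (s - u) (g u) := by
    intro T hT s hs
    rcases lt_or_ge s 0 with h | h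
    · rw [hxneg s ⟨hs.1, h⟩, convolution_causal_of_neg hT h]
    · rw [hxpos s h, convolution_causal_of_mem_Icc hXc (hg T hT) ⟨h, hs.2⟩]
  refine ⟨hxneg, by rw [hxpos 0 le_rfl, intervalIntegral.integral_same], fun t ht => ?_,
    fun t ht => ?_⟩
  · have ht : 0 ≤ t := ht
    have hT : 0 ≤ t + 1 := by linarith
    refine (continuous_convolution_causal hXc hT (hg _ hT)).continuousWithinAt.congr_of_eventuallyEq
      ?_ ?_
    · filter_upwards [self_mem_nhdsWithin, mem_nhdsWithin_of_mem_nhds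
        (Iio_mem_nhds (lt_add_one t))] with s hs0 hs
      rw [hxpos s hs0, convolution_causal_of_mem_Icc hXc (hg _ hT) ⟨hs0, le_of_lt hs⟩]
    · rw [hxpos t ht, convolution_causal_of_mem_Icc hXc (hg _ hT) ⟨ht, by linarith⟩]
  · have hP := intervalIntegrable_primitiveSegment (r := r) hXc (hg t ht)
    refine ⟨∫ u in (0 : ℝ)..t, primitiveSegment r hXc (t - u, g u), fun θ => ?_, ?_⟩
    · have hθ := θ.2
      have heval := ContinuousLinearMap.intervalIntegral_comp_comm
        (ContinuousMap.evalCLM 𝕜 θ : C(Icc (-r) (0 : ℝ), Fin n → 𝕜) →L[𝕜] (Fin n → 𝕜)) hP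
      have hx : ∫ s in (θ : ℝ)..(t + θ), x s =
          ∫ s in (θ : ℝ)..(t + θ), ∫ u in (0 : ℝ)..t, (Ici (0 : ℝ)).indicator X (s - u) (g u) := by
        refine intervalIntegral.integral_congr fun s hs => ?_
        rw [uIcc_of_le (by linarith)] at hs
        exact hxT t ht s ⟨hθ.1.trans hs.1, hs.2.trans (by linarith [hθ.2])⟩
      rw [hx, integral_convolution_causal hXc ht (hg t ht) hθ.2]
      refine heval.symm.trans (intervalIntegral.integral_congr fun u _ => ?_)
      change primitiveSegment r hXc (t - u, g u) θ = _
      rw [primitiveSegment_apply, show t - u + (θ : ℝ) = t + θ - u by ring]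
    · have hLP : IntervalIntegrable (fun u => L (primitiveSegment r hXc (t - u, g u))) volume 0 t :=
        ⟨L.integrable_comp hP.1, L.integrable_comp hP.2⟩
      rw [hxpos t ht, ← L.intervalIntegral_comp_comm hP, zero_add, add_comm,
        ← intervalIntegral.integral_add (hg t ht) hLP]
      refine intervalIntegral.integral_congr fun u hu => ?_
      rw [uIcc_of_le ht] at hu
      exact hX.apply_eq (sub_nonneg.2 hu.2) (g u)

end Existence

/-- For locally Lebesgue integrable `g`, the function `x(t) = ∫_0^t X^L(t-u) g(u) du`
(zero on `[-r,0)`) is the unique solution with zero initial datum of the integral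
equation with forcing term `Vg : t ↦ ∫_0^t g(u) du`. -/
theorem stmt_11 {𝕜 : Type*} [RCLike 𝕜] {n : ℕ} (hn : 0 < n) {r : ℝ} (hr : 0 < r)
    (L : C(Set.Icc (-r) (0:ℝ), Fin n → 𝕜) →L[𝕜] (Fin n → 𝕜))
    (X : ℝ → ((Fin n → 𝕜) →L[𝕜] (Fin n → 𝕜))) (hX : IsPFMS r L X)
    (g : ℝ → Fin n → 𝕜) (hg : LocallyIntegrableOn g (Set.Ici (0:ℝ)))
    (x : ℝ → Fin n → 𝕜)
    (hxneg : ∀ t ∈ Set.Ico (-r) (0:ℝ), x t = 0)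
    (hxpos : ∀ t, 0 ≤ t → x t = ∫ u in (0:ℝ)..t, X (t - u) (g u)) :
    IsSolForced r L (fun _ => 0) 0 (fun t => ∫ u in (0:ℝ)..t, g u) x ∧
      ∀ x' : ℝ → Fin n → 𝕜,
        IsSolForced r L (fun _ => 0) 0 (fun t => ∫ u in (0:ℝ)..t, g u) x' →
        ∀ t, 0 ≤ t → x' t = x t := by
  have hgI : ∀ T, 0 ≤ T → IntervalIntegrable g volume 0 T := fun T hT =>
    (intervalIntegrable_iff_integrableOn_Icc_of_le hT).2
      (hg.integrableOn_compact_subset Icc_subset_Ici_self isCompact_Icc)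
  have hsol := hX.isSolForced_convolution hgI hxneg hxpos
  exact ⟨hsol, fun x' hx' t ht => hsol.eq_of_zero_history hx' ht⟩
end

section
/- Suppose there exist constants M₀ ≥ 1 and α > 0 such that |X^L(t)| ≤ M₀ e^{-αt} for all t ≥ 0 (operator norm). Then there exists a constant M ≥ 1 such that for every φ ∈ C([-r,0],𝕂ⁿ) and every t ≥ 0, the mild solution x of ẋ(t) = L x_t with continuous initial history φ satisfies sup_{θ∈[-r,0]} |x(t+θ)| ≤ M e^{-αt} ‖φ‖. -/
open MeasureTheory

/-- `x` is the mild solution of `ẋ(t) = L x_t` with continuous initial history `φ`: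
`x = φ` on `[-r,0]`, `x` continuous on `[-r,∞)`, and `x(t) = φ(0) + L(∫_0^t x_s ds)`
for all `t ≥ 0`. -/
def IsMildSolC {𝕜 : Type*} [RCLike 𝕜] {n : ℕ} (r : ℝ)
    (L : C(Set.Icc (-r) (0:ℝ), Fin n → 𝕜) →L[𝕜] (Fin n → 𝕜))
    (φ : C(Set.Icc (-r) (0:ℝ), Fin n → 𝕜)) (x : ℝ → Fin n → 𝕜) : Prop :=
  (∀ θ : Set.Icc (-r) (0:ℝ), x θ = φ θ) ∧
  ContinuousOn x (Set.Ici (-r)) ∧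
  ∀ t, 0 ≤ t → ∃ ψ : C(Set.Icc (-r) (0:ℝ), Fin n → 𝕜),
    (∀ θ : Set.Icc (-r) (0:ℝ), ψ θ = ∫ s in (θ : ℝ)..(t + (θ : ℝ)), x s) ∧
    x t = x 0 + L ψ

/-- Interchange of the order of integration over the triangle `0 ≤ s ≤ v ≤ T`. -/
lemma integral_integral_triangle_swap {F : Type*} [NormedAddCommGroup F] [NormedSpace ℝ F]
    {K : ℝ → ℝ → F} (hK : Continuous (Function.uncurry K)) {T : ℝ} (hT : 0 ≤ T) :
    ∫ v in (0:ℝ)..T, ∫ s in (0:ℝ)..v, K v s = ∫ s in (0:ℝ)..T, ∫ v in s..T, K v s := by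
  let G : ℝ → ℝ → F := fun v s => {p : ℝ × ℝ | p.2 ≤ p.1}.indicator (Function.uncurry K) (v, s)
  have hG : Integrable (Function.uncurry G)
      (volume.restrict (Set.uIoc 0 T ×ˢ Set.uIoc 0 T)) := by
    have hm : MeasurableSet {p : ℝ × ℝ | p.2 ≤ p.1} :=
      measurableSet_le measurable_snd measurable_fst
    refine Integrable.indicator (f := Function.uncurry K) ?_ hm
    refine IntegrableOn.mono_set (t := Set.Icc 0 T ×ˢ Set.Icc 0 T) ?_ ?_
    · exact hK.continuousOn.integrableOn_compact (isCompact_Icc.prod isCompact_Icc)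
    · rw [Set.uIoc_of_le hT]
      exact Set.prod_mono Set.Ioc_subset_Icc_self Set.Ioc_subset_Icc_self
  have key := intervalIntegral_intervalIntegral_swap hG
  have inner₁ : ∀ v ∈ Set.uIcc 0 T, ∫ s in (0:ℝ)..T, G v s = ∫ s in (0:ℝ)..v, K v s := by
    intro v hv
    rw [Set.uIcc_of_le hT] at hv
    have hGv : G v = (Set.Iic v).indicator (K v) := by
      ext s
      simp [G, Set.indicator, Function.uncurry]
    rw [hGv, intervalIntegral.integral_of_le hT, intervalIntegral.integral_of_le hv.1,
      setIntegral_indicator measurableSet_Iic, Set.Ioc_inter_Iic, min_eq_right hv.2]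
  have inner₂ : ∀ s ∈ Set.uIcc 0 T, ∫ v in (0:ℝ)..T, G v s = ∫ v in s..T, K v s := by
    intro s hs
    rw [Set.uIcc_of_le hT] at hs
    have hGs : (fun v => G v s) = (Set.Ici s).indicator (fun v => K v s) := by
      ext v
      simp [G, Set.indicator, Function.uncurry]
    rw [hGs, intervalIntegral.integral_of_le hT, intervalIntegral.integral_of_le hs.2,
      setIntegral_indicator measurableSet_Ici]
    refine setIntegral_congr_set ?_
    have h₁ : (Set.Ioc 0 T ∩ Set.Ici s : Set ℝ) =ᵐ[volume] (Set.Icc 0 T ∩ Set.Ici s : Set ℝ) :=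
      Ioc_ae_eq_Icc.inter (Filter.EventuallyEq.refl _ _)
    have h₂ : Set.Icc 0 T ∩ Set.Ici s = Set.Icc s T := by
      ext v
      simp only [Set.mem_inter_iff, Set.mem_Icc, Set.mem_Ici]
      exact ⟨fun h => ⟨h.2, h.1.2⟩, fun h => ⟨⟨hs.1.trans h.1, h.2⟩, h.1⟩⟩
    rw [h₂] at h₁
    exact h₁.trans Ioc_ae_eq_Icc.symm
  rw [intervalIntegral.integral_congr inner₁, intervalIntegral.integral_congr inner₂] at key
  exact key

/-- A nonnegative function dominated by a multiple of its own primitive vanishes. -/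
lemma eq_zero_of_le_mul_integral_s13 {u : ℝ → ℝ} (hu : Continuous u) (hu0 : ∀ t, 0 ≤ u t) {C : ℝ}
    (h : ∀ t, 0 ≤ t → u t ≤ C * ∫ s in (0:ℝ)..t, u s) {t : ℝ} (ht : 0 ≤ t) : u t = 0 := by
  have hI : ∀ s, HasDerivAt (fun w => ∫ s in (0:ℝ)..w, u s) (u s) s := fun s =>
    intervalIntegral.integral_hasDerivAt_right (hu.intervalIntegrable _ _)
      (hu.stronglyMeasurableAtFilter _ _) hu.continuousAt
  have hz := eq_zero_of_abs_deriv_le_mul_abs_self_of_eq_zero_right (K := C) (a := 0) (b := t)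
    (f := fun w => ∫ s in (0:ℝ)..w, u s) (f' := u)
    (fun s _ => (hI s).continuousAt.continuousWithinAt)
    (fun s _ => (hI s).hasDerivWithinAt) (by simp) (by
      intro s hs
      rw [Real.norm_of_nonneg (hu0 s), Real.norm_of_nonneg
        (intervalIntegral.integral_nonneg hs.1 fun w _ => hu0 w)]
      exact h s hs.1) t ⟨ht, le_rfl⟩
  have := h t ht
  beta_reduce at hz
  rw [hz, mul_zero] at this
  exact le_antisymm this (hu0 t)

/-- A jointly continuous function of `s` and `θ`, seen as a continuous curve of continuous
functions of `θ`, may be integrated in `s` before or after applying `L`. -/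
lemma map_integral_curry {𝕜 : Type*} [RCLike 𝕜] {E F : Type*} [NormedAddCommGroup E]
    [NormedSpace 𝕜 E] [NormedSpace ℝ E] [CompleteSpace E]
    [NormedAddCommGroup F] [NormedSpace 𝕜 F] [NormedSpace ℝ F] [CompleteSpace F]
    {S : Type*} [TopologicalSpace S] [CompactSpace S]
    (L : C(S, E) →L[𝕜] F) (H : C(ℝ × S, E)) (a b : ℝ) (ψ : C(S, E))
    (hψ : ∀ θ, ψ θ = ∫ s in a..b, H (s, θ)) :
    L ψ = ∫ s in a..b, L (H.curry s) := by
  have hint : IntervalIntegrable (fun s => H.curry s) volume a b :=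
    H.curry.continuous.intervalIntegrable _ _
  rw [ContinuousLinearMap.intervalIntegral_comp_comm L hint]
  congr 1
  ext θ
  rw [hψ θ]
  exact ContinuousLinearMap.intervalIntegral_comp_comm (ContinuousMap.evalCLM 𝕜 θ) hint

/-- The convolution of the principal fundamental matrix solution with a continuous forcing term
solves the inhomogeneous equation `ż(t) = L z_t + f(t)` in integrated form, with zero history. -/
lemma IsPFMS.convolution_eq {𝕜 : Type*} [RCLike 𝕜] {n : ℕ} {r : ℝ}
    {L : C(Set.Icc (-r) (0:ℝ), Fin n → 𝕜) →L[𝕜] (Fin n → 𝕜)}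
    {X : ℝ → ((Fin n → 𝕜) →L[𝕜] (Fin n → 𝕜))} (hX : IsPFMS r L X)
    {f z : ℝ → Fin n → 𝕜} (hf : Continuous f)
    (hz : ∀ t, z t = ∫ s in (0:ℝ)..t, X (max (t - s) 0) (f s))
    {t : ℝ} (ht : 0 ≤ t) (ζ : C(Set.Icc (-r) (0:ℝ), Fin n → 𝕜))
    (hζ : ∀ θ : Set.Icc (-r) (0:ℝ), ζ θ = ∫ v in (0:ℝ)..max (t + θ) 0, z v) :
    z t = (∫ s in (0:ℝ)..t, f s) + L ζ := by
  obtain ⟨-, hXc, -, hXL⟩ := hX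
  have hXe : Continuous fun u => X (max u 0) :=
    hXc.comp_continuous (by fun_prop) fun u => le_max_right u 0
  set Y : ℝ → ((Fin n → 𝕜) →L[𝕜] (Fin n → 𝕜)) := fun u => ∫ v in (0:ℝ)..max u 0, X (max v 0)
    with hY
  have hYc : Continuous Y :=
    (intervalIntegral.continuous_primitive (fun a b => hXe.intervalIntegrable a b) 0).comp
      (by fun_prop : Continuous fun u : ℝ => max u 0)
  have hYapply : ∀ u ξ, Y u ξ = ∫ v in (0:ℝ)..max u 0, X (max v 0) ξ := fun u ξ =>
    ContinuousLinearMap.intervalIntegral_apply (hXe.intervalIntegrable _ _) ξ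
  let H : C(ℝ × Set.Icc (-r) (0:ℝ), Fin n → 𝕜) :=
    ⟨fun p => Y (t - p.1 + p.2) (f p.1), by fun_prop⟩
  have hpt : ∀ s ∈ Set.uIcc 0 t, X (max (t - s) 0) (f s) = f s + L (H.curry s) := by
    intro s hs
    rw [Set.uIcc_of_le ht] at hs
    obtain ⟨ψ, hψ, hψL⟩ := hXL (f s) (t - s) (sub_nonneg.2 hs.2)
    rw [max_eq_left (sub_nonneg.2 hs.2), hψL]
    congr 2
    ext1 θ
    rw [hψ θ]
    change _ = Y (t - s + θ) (f s)
    rw [hYapply]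
    refine intervalIntegral.integral_congr fun v hv => ?_
    rw [Set.uIcc_of_le (le_max_right _ _)] at hv
    simp only [max_eq_left hv.1]
  have hLH : Continuous fun s => L (H.curry s) := L.continuous.comp H.curry.continuous
  rw [hz t, intervalIntegral.integral_congr hpt,
    intervalIntegral.integral_add (hf.intervalIntegrable _ _) (hLH.intervalIntegrable _ _)]
  congr 1
  refine (map_integral_curry L H 0 t ζ fun θ => ?_).symm
  rw [hζ θ]
  change _ = ∫ s in (0:ℝ)..t, Y (t - s + θ) (f s)
  have hYneg : ∀ u, u ≤ 0 → Y u = 0 := fun u hu => by simp [hY, max_eq_right hu]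
  set T := max (t + (θ : ℝ)) 0 with hT
  have hT0 : 0 ≤ T := le_max_right _ _
  have hTt : T ≤ t := max_le (by linarith [θ.2.2]) ht
  have hYf : Continuous fun s => Y (t - s + θ) (f s) := by fun_prop
  have hK : Continuous (Function.uncurry fun v s => X (max (v - s) 0) (f s)) := by
    have h₁ : Continuous fun p : ℝ × ℝ => X (max (p.1 - p.2) 0) :=
      hXe.comp (continuous_fst.sub continuous_snd)
    exact h₁.clm_apply (hf.comp continuous_snd)
  have htail : ∫ s in T..t, Y (t - s + θ) (f s) = 0 := by
    rw [intervalIntegral.integral_congr (g := fun _ => 0), intervalIntegral.integral_zero]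
    intro s hs
    rw [Set.uIcc_of_le hTt] at hs
    have : t + (θ : ℝ) ≤ s := (le_max_left _ _).trans hs.1
    simp only [hYneg (t - s + θ) (by linarith), zero_apply]
  rw [← intervalIntegral.integral_add_adjacent_intervals (hYf.intervalIntegrable 0 T)
    (hYf.intervalIntegrable T t), htail, add_zero]
  simp only [hz]
  rw [integral_integral_triangle_swap hK hT0]
  refine intervalIntegral.integral_congr fun s hs => ?_
  rw [Set.uIcc_of_le hT0] at hs
  rw [hYapply, intervalIntegral.integral_comp_sub_right (fun w => X (max w 0) (f s)), sub_self]
  rcases le_total (t + (θ : ℝ)) 0 with h | h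
  · have hT' : T = 0 := max_eq_right h
    have hs' : s = 0 := le_antisymm (hs.2.trans hT'.le) hs.1
    rw [hT', hs', max_eq_right (by linarith), sub_zero]
  · have hT' : T = t + θ := max_eq_left h
    rw [max_eq_left (by linarith [hs.2]), hT']
    congr 1
    ring

/-- Variation of constants: if `x` solves `ẋ(t) = L x_t` with history `φ` and `y` continues `φ`
as a `C¹` function on `[0,∞)` with derivative `y'`, then `x - y` is the convolution of the principal
fundamental matrix solution with the defect `L y_t - y'(t)`. -/
lemma IsMildSolC.eq_add_convolution {𝕜 : Type*} [RCLike 𝕜] {n : ℕ} {r : ℝ} (hr : 0 < r)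
    {L : C(Set.Icc (-r) (0:ℝ), Fin n → 𝕜) →L[𝕜] (Fin n → 𝕜)}
    {X : ℝ → ((Fin n → 𝕜) →L[𝕜] (Fin n → 𝕜))} (hX : IsPFMS r L X)
    {φ : C(Set.Icc (-r) (0:ℝ), Fin n → 𝕜)} {x : ℝ → Fin n → 𝕜} (hx : IsMildSolC r L φ x)
    {y y' : ℝ → Fin n → 𝕜} (H : C(ℝ × Set.Icc (-r) (0:ℝ), Fin n → 𝕜))
    (hy : Continuous y) (hy' : Continuous y') (hH : ∀ s θ, H (s, θ) = y (s + θ))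
    (hyφ : ∀ θ : Set.Icc (-r) (0:ℝ), y θ = φ θ)
    (hyy' : ∀ t, 0 ≤ t → y t = y 0 + ∫ s in (0:ℝ)..t, y' s) {t : ℝ} (ht : 0 ≤ t) :
    x t = y t + ∫ s in (0:ℝ)..t, X (max (t - s) 0) (L (H.curry s) - y' s) := by
  obtain ⟨hxφ, hxc, hxL⟩ := hx
  have hxy : ∀ s ∈ Set.Icc (-r) 0, x s = y s := fun s hs =>
    (hxφ ⟨s, hs⟩).trans (hyφ ⟨s, hs⟩).symm
  have hLH : Continuous fun s => L (H.curry s) := L.continuous.comp H.curry.continuous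
  have hf : Continuous fun s => L (H.curry s) - y' s := hLH.sub hy'
  have hXe : Continuous fun u => X (max u 0) :=
    hX.2.1.comp_continuous (by fun_prop) fun u => le_max_right u 0
  set z : ℝ → Fin n → 𝕜 := fun t => ∫ s in (0:ℝ)..t, X (max (t - s) 0) (L (H.curry s) - y' s)
  have hzc : Continuous z := by
    refine intervalIntegral.continuous_parametric_intervalIntegral_of_continuous
      (f := fun t s => X (max (t - s) 0) (L (H.curry s) - y' s)) ?_ continuous_id
    have h₁ : Continuous fun p : ℝ × ℝ => X (max (p.1 - p.2) 0) :=
      hXe.comp (continuous_fst.sub continuous_snd)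
    exact h₁.clm_apply (hf.comp continuous_snd)
  have hxe : Continuous fun s => x (max s 0) :=
    hxc.comp_continuous (by fun_prop) fun s =>
      (neg_nonpos.2 hr.le).trans (le_max_right s 0)
  set d : ℝ → Fin n → 𝕜 := fun s => x (max s 0) - y (max s 0) - z (max s 0) with hd
  have hm : Continuous fun s : ℝ => max s 0 := by fun_prop
  have hdc : Continuous d := (hxe.sub (hy.comp hm)).sub (hzc.comp hm)
  have hxi : ∀ a b, -r ≤ a → -r ≤ b → IntervalIntegrable x volume a b := fun a b ha hb =>
    (hxc.mono fun s hs => (le_inf ha hb).trans hs.1).intervalIntegrable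
  have hdL : ∀ t, 0 ≤ t → ‖d t‖ ≤ ‖L‖ * ∫ s in (0:ℝ)..t, ‖d s‖ := by
    intro t ht
    obtain ⟨ψ, hψ, hψL⟩ := hxL t ht
    let η : C(Set.Icc (-r) (0:ℝ), Fin n → 𝕜) :=
      ⟨fun θ => ∫ s in (0:ℝ)..t, y (s + θ), by
        refine intervalIntegral.continuous_parametric_intervalIntegral_of_continuous'
          (f := fun (θ : Set.Icc (-r) (0:ℝ)) s => y (s + θ)) ?_ 0 t
        exact hy.comp (continuous_snd.add (continuous_subtype_val.comp continuous_fst))⟩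
    let ζ : C(Set.Icc (-r) (0:ℝ), Fin n → 𝕜) :=
      ⟨fun θ => ∫ v in (0:ℝ)..max (t + θ) 0, z v,
        (intervalIntegral.continuous_primitive (fun a b => hzc.intervalIntegrable a b) 0).comp
          (by fun_prop : Continuous fun θ : Set.Icc (-r) (0:ℝ) => max (t + (θ : ℝ)) 0)⟩
    have hη : L η = ∫ s in (0:ℝ)..t, L (H.curry s) :=
      map_integral_curry L H 0 t η fun θ => by simp only [hH]; rfl
    have hzt := hX.convolution_eq (z := z) hf (fun _ => rfl) ht ζ fun _ => rfl
    rw [intervalIntegral.integral_sub (hLH.intervalIntegrable _ _) (hy'.intervalIntegrable _ _),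
      ← hη] at hzt
    have hdt : d t = L (ψ - η - ζ) := by
      simp only [hd, max_eq_left ht, map_sub]
      rw [hψL, hyy' t ht, hzt, hxy 0 ⟨by linarith, le_rfl⟩]
      abel
    rw [hdt]
    refine (L.le_opNorm _).trans (mul_le_mul_of_nonneg_left ?_ (norm_nonneg _))
    have hpos : ∀ T, 0 ≤ T → 0 ≤ ∫ s in (0:ℝ)..T, ‖d s‖ := fun T hT =>
      intervalIntegral.integral_nonneg hT fun _ _ => norm_nonneg _
    refine (ContinuousMap.norm_le _ (hpos t ht)).2 fun θ => ?_
    set T := max (t + (θ : ℝ)) 0 with hT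
    have hT0 : 0 ≤ T := le_max_right _ _
    have hTt : T ≤ t := max_le (by linarith [θ.2.2]) ht
    have hθ := θ.2
    have hxyi : ∀ a b, -r ≤ a → -r ≤ b → IntervalIntegrable (fun s => x s - y s) volume a b :=
      fun a b ha hb => (hxi a b ha hb).sub (hy.intervalIntegrable _ _)
    have hzero : ∀ a b, a ∈ Set.Icc (-r) 0 → b ∈ Set.Icc (-r) 0 →
        ∫ s in a..b, (x s - y s) = 0 := by
      intro a b ha hb
      rw [intervalIntegral.integral_congr (g := fun _ => 0), intervalIntegral.integral_zero]
      intro s hs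
      have := Set.uIcc_subset_Icc ha hb hs
      simp only [hxy s this, sub_self]
    have hval : (ψ - η - ζ) θ = ∫ s in (0:ℝ)..T, d s := by
      have h₁ : η θ = ∫ s in (θ : ℝ)..(t + θ), y s := by
        change ∫ s in (0:ℝ)..t, y (s + θ) = _
        rw [intervalIntegral.integral_comp_add_right, zero_add]
      have h₂ : ∫ s in (θ : ℝ)..(t + θ), (x s - y s) = ∫ s in (0:ℝ)..T, (x s - y s) := by
        have hr0 : (-r : ℝ) ≤ 0 := by linarith
        have htθ : -r ≤ t + (θ : ℝ) := by linarith [hθ.1]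
        rw [← intervalIntegral.integral_add_adjacent_intervals (hxyi θ 0 hθ.1 hr0)
          (hxyi 0 (t + θ) hr0 htθ), hzero θ 0 hθ ⟨hr0, le_rfl⟩, zero_add]
        rcases le_total (t + (θ : ℝ)) 0 with h | h
        · rw [hzero 0 (t + θ) ⟨hr0, le_rfl⟩ ⟨htθ, h⟩, hT, max_eq_right h,
            intervalIntegral.integral_same]
        · rw [hT, max_eq_left h]
      change ψ θ - η θ - (∫ v in (0:ℝ)..T, z v) = _
      rw [hψ θ, h₁, ← intervalIntegral.integral_sub
        (hxi _ _ hθ.1 (by linarith [hθ.1])) (hy.intervalIntegrable _ _), h₂,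
        ← intervalIntegral.integral_sub (hxyi 0 T (by linarith) (by linarith))
          (hzc.intervalIntegrable _ _)]
      refine intervalIntegral.integral_congr fun s hs => ?_
      rw [Set.uIcc_of_le hT0] at hs
      simp only [hd, max_eq_left hs.1]
    rw [hval]
    calc ‖∫ s in (0:ℝ)..T, d s‖ ≤ ∫ s in (0:ℝ)..T, ‖d s‖ :=
          intervalIntegral.norm_integral_le_integral_norm hT0
      _ ≤ ∫ s in (0:ℝ)..t, ‖d s‖ :=
          intervalIntegral.integral_mono_interval le_rfl hT0 hTt
            (Filter.Eventually.of_forall fun _ => norm_nonneg _)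
            (hdc.norm.intervalIntegrable _ _)
  have hd0 : ‖d t‖ = 0 :=
    eq_zero_of_le_mul_integral_s13 hdc.norm (fun _ => norm_nonneg _) hdL ht
  have hd1 : x t - y t - z t = 0 := by
    simpa only [hd, max_eq_left ht] using norm_eq_zero.1 hd0
  rw [sub_sub, sub_eq_zero] at hd1
  exact hd1

/-- If the principal fundamental matrix solution is `α`-exponentially stable, then the
solution semigroup is uniformly `α`-exponentially stable. -/
theorem stmt_13 {𝕜 : Type*} [RCLike 𝕜] {n : ℕ} (hn : 0 < n) {r : ℝ} (hr : 0 < r)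
    (L : C(Set.Icc (-r) (0:ℝ), Fin n → 𝕜) →L[𝕜] (Fin n → 𝕜))
    (X : ℝ → ((Fin n → 𝕜) →L[𝕜] (Fin n → 𝕜))) (hX : IsPFMS r L X)
    {M₀ α : ℝ} (hM₀ : 1 ≤ M₀) (hα : 0 < α)
    (hdecay : ∀ t, 0 ≤ t → ‖X t‖ ≤ M₀ * Real.exp (-α * t)) :
    ∃ M : ℝ, 1 ≤ M ∧
      ∀ (φ : C(Set.Icc (-r) (0:ℝ), Fin n → 𝕜)) (x : ℝ → Fin n → 𝕜),
        IsMildSolC r L φ x →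
        ∀ t, 0 ≤ t → ∀ θ ∈ Set.Icc (-r) (0:ℝ),
          ‖x (t + θ)‖ ≤ M * Real.exp (-α * t) * ‖φ‖ := by
  obtain ⟨q, q', hqd, hq'c, hq1, hq0, hq'0, hq01⟩ : ∃ q q' : ℝ → ℝ,
      (∀ s, HasDerivAt q (q' s) s) ∧ Continuous q' ∧ (∀ s, s ≤ 0 → q s = 1) ∧
      (∀ s, r ≤ s → q s = 0) ∧ (∀ s, 2 * r ≤ s → q' s = 0) ∧ ∀ s, |q s| ≤ 1 := by
    have hc : ContDiff ℝ 1 fun s : ℝ => Real.smoothTransition (1 - s / r) :=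
      (Real.smoothTransition.contDiff (n := 1)).comp (by fun_prop)
    have h0 : ∀ s, r ≤ s → Real.smoothTransition (1 - s / r) = 0 := fun s hs =>
      Real.smoothTransition.zero_of_nonpos (sub_nonpos.2 ((one_le_div hr).2 hs))
    refine ⟨_, deriv fun s : ℝ => Real.smoothTransition (1 - s / r),
      fun s => (hc.differentiable (by norm_num) s).hasDerivAt, hc.continuous_deriv le_rfl,
      fun s hs => Real.smoothTransition.one_of_one_le ?_, h0, fun s hs => ?_, fun s => ?_⟩
    · linarith [div_nonpos_of_nonpos_of_nonneg hs hr.le]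
    · have : (fun s : ℝ => Real.smoothTransition (1 - s / r)) =ᶠ[nhds s] fun _ => 0 := by
        filter_upwards [lt_mem_nhds (show r < s by linarith)] with w hw using h0 w hw.le
      rw [this.deriv_eq, deriv_const]
    · rw [abs_of_nonneg (Real.smoothTransition.nonneg _)]
      exact Real.smoothTransition.le_one _
  obtain ⟨K, hK⟩ := (isCompact_Icc (a := 0) (b := 2 * r)).exists_bound_of_continuousOn
    hq'c.continuousOn
  have hK0 : 0 ≤ K := (norm_nonneg _).trans (hK 0 ⟨le_rfl, by linarith⟩)
  set D := (‖L‖ + K) * Real.exp ((α + 1) * (2 * r)) with hD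
  have hD0 : 0 ≤ D := by positivity
  have hM₀0 : 0 ≤ M₀ := zero_le_one.trans hM₀
  have hexp1 : 1 ≤ Real.exp (α * r) := Real.one_le_exp (by positivity)
  set B := Real.exp (α * r) + M₀ * D with hB
  have hB1 : 1 ≤ B := by
    have : 0 ≤ M₀ * D := by positivity
    linarith
  refine ⟨B * Real.exp (α * r), one_le_mul_of_one_le_of_one_le hB1 hexp1, ?_⟩
  intro φ x hx
  have hr0 : -r ≤ (0:ℝ) := by linarith
  have h0mem : (0:ℝ) ∈ Set.Icc (-r) 0 := ⟨hr0, le_rfl⟩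
  have hqc : Continuous q := continuous_iff_continuousAt.2 fun s => (hqd s).continuousAt
  set y : ℝ → Fin n → 𝕜 := fun s => q s • φ (Set.projIcc (-r) 0 hr0 s) with hy
  have hyc : Continuous y := hqc.smul (φ.continuous.comp continuous_projIcc)
  have hy_nonneg : ∀ s, 0 ≤ s → y s = q s • φ ⟨0, h0mem⟩ := fun s hs => by
    simp only [hy, Set.projIcc_of_right_le hr0 hs]
  have hy_le : ∀ s, ‖y s‖ ≤ ‖φ‖ := fun s => by
    rw [hy, norm_smul, Real.norm_eq_abs]
    exact (mul_le_of_le_one_left (norm_nonneg _) (hq01 s)).trans (φ.norm_coe_le_norm _)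
  have hy_zero : ∀ s, r ≤ s → y s = 0 := fun s hs => by simp only [hy, hq0 s hs, zero_smul]
  have hyφ : ∀ θ : Set.Icc (-r) (0:ℝ), y θ = φ θ := fun θ => by
    simp only [hy, hq1 θ θ.2.2, one_smul, Set.projIcc_val]
  set y' : ℝ → Fin n → 𝕜 := fun s => q' s • φ ⟨0, h0mem⟩ with hy'
  have hy'c : Continuous y' := hq'c.smul continuous_const
  have hyy' : ∀ t, 0 ≤ t → y t = y 0 + ∫ s in (0:ℝ)..t, y' s := by
    intro t ht
    rw [intervalIntegral.integral_eq_sub_of_hasDerivAt (f := fun s => q s • φ ⟨0, h0mem⟩)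
      (fun s _ => (hqd s).smul_const _) (hy'c.intervalIntegrable _ _), hy_nonneg t ht,
      hy_nonneg 0 le_rfl]
    abel
  let H : C(ℝ × Set.Icc (-r) (0:ℝ), Fin n → 𝕜) := ⟨fun p => y (p.1 + p.2), by fun_prop⟩
  set f : ℝ → Fin n → 𝕜 := fun s => L (H.curry s) - y' s with hf
  have hf_le : ∀ s, 0 ≤ s → ‖f s‖ ≤ D * ‖φ‖ * Real.exp (-(α + 1) * s) := by
    intro s hs
    rcases le_total s (2 * r) with h | h
    · have h₁ : ‖L (H.curry s)‖ ≤ ‖L‖ * ‖φ‖ :=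
        L.le_opNorm_of_le ((ContinuousMap.norm_le _ (norm_nonneg _)).2 fun θ => hy_le _)
      have h₂ : ‖y' s‖ ≤ K * ‖φ‖ := by
        rw [hy', norm_smul]
        exact mul_le_mul (hK s ⟨hs, h⟩) (φ.norm_coe_le_norm _) (norm_nonneg _) hK0
      have h₃ : 1 ≤ Real.exp ((α + 1) * (2 * r)) * Real.exp (-(α + 1) * s) := by
        rw [← Real.exp_add]
        exact Real.one_le_exp (by nlinarith)
      calc ‖f s‖ ≤ ‖L (H.curry s)‖ + ‖y' s‖ := norm_sub_le _ _
        _ ≤ (‖L‖ + K) * ‖φ‖ := by linarith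
        _ ≤ (‖L‖ + K) * ‖φ‖ * (Real.exp ((α + 1) * (2 * r)) * Real.exp (-(α + 1) * s)) :=
          le_mul_of_one_le_right (by positivity) h₃
        _ = D * ‖φ‖ * Real.exp (-(α + 1) * s) := by rw [hD]; ring
    · have hH0 : H.curry s = 0 := by
        ext1 θ
        exact hy_zero _ (by linarith [θ.2.1])
      have : f s = 0 := by simp only [hf, hH0, map_zero, hy', hq'0 s h, zero_smul, sub_zero]
      rw [this, norm_zero]
      positivity
  have hx_le : ∀ t, 0 ≤ t → ‖x t‖ ≤ B * Real.exp (-α * t) * ‖φ‖ := by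
    intro t ht
    rw [hx.eq_add_convolution hr hX H hyc hy'c (fun _ _ => rfl) hyφ hyy' ht]
    have h₁ : ‖y t‖ ≤ Real.exp (α * r) * Real.exp (-α * t) * ‖φ‖ := by
      rcases le_total t r with h | h
      · refine (hy_le t).trans (le_mul_of_one_le_left (norm_nonneg _) ?_)
        rw [← Real.exp_add]
        exact Real.one_le_exp (by nlinarith)
      · rw [hy_zero t h, norm_zero]
        positivity
    have h₂ : ‖∫ s in (0:ℝ)..t, X (max (t - s) 0) (f s)‖ ≤
        ∫ s in (0:ℝ)..t, M₀ * D * ‖φ‖ * Real.exp (-α * t) * Real.exp (-s) := by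
      refine intervalIntegral.norm_integral_le_of_norm_le ht
        (Filter.Eventually.of_forall fun s hs => ?_)
        (Continuous.intervalIntegrable (by fun_prop) _ _)
      have hts : 0 ≤ t - s := sub_nonneg.2 hs.2
      rw [max_eq_left hts]
      calc ‖X (t - s) (f s)‖ ≤ ‖X (t - s)‖ * ‖f s‖ := ContinuousLinearMap.le_opNorm _ _
        _ ≤ (M₀ * Real.exp (-α * (t - s))) * (D * ‖φ‖ * Real.exp (-(α + 1) * s)) :=
          mul_le_mul (hdecay _ hts) (hf_le s hs.1.le) (norm_nonneg _) (by positivity)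
        _ = M₀ * D * ‖φ‖ * (Real.exp (-α * (t - s)) * Real.exp (-(α + 1) * s)) := by ring
        _ = M₀ * D * ‖φ‖ * (Real.exp (-α * t) * Real.exp (-s)) := by
          rw [← Real.exp_add, ← Real.exp_add]
          ring_nf
        _ = M₀ * D * ‖φ‖ * Real.exp (-α * t) * Real.exp (-s) := by ring
    have h₃ : ∫ s in (0:ℝ)..t, Real.exp (-s) ≤ 1 := by
      rw [intervalIntegral.integral_comp_neg (fun s => Real.exp s), integral_exp]
      simp [(Real.exp_pos _).le]
    rw [intervalIntegral.integral_const_mul] at h₂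
    have h₄ : M₀ * D * ‖φ‖ * Real.exp (-α * t) * ∫ s in (0:ℝ)..t, Real.exp (-s) ≤
        M₀ * D * ‖φ‖ * Real.exp (-α * t) := mul_le_of_le_one_right (by positivity) h₃
    calc _ ≤ ‖y t‖ + ‖∫ s in (0:ℝ)..t, X (max (t - s) 0) (f s)‖ := norm_add_le _ _
      _ ≤ Real.exp (α * r) * Real.exp (-α * t) * ‖φ‖ + M₀ * D * ‖φ‖ * Real.exp (-α * t) :=
        add_le_add h₁ (h₂.trans h₄)
      _ = B * Real.exp (-α * t) * ‖φ‖ := by rw [hB]; ring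
  intro t ht θ hθ
  rcases le_total 0 (t + θ) with h | h
  · refine (hx_le _ h).trans (mul_le_mul_of_nonneg_right ?_ (norm_nonneg _))
    rw [mul_assoc, ← Real.exp_add]
    refine mul_le_mul_of_nonneg_left (Real.exp_le_exp.2 ?_) (by positivity)
    nlinarith [hθ.1]
  · have hmem : t + θ ∈ Set.Icc (-r) 0 := ⟨by linarith [hθ.1], h⟩
    have h₁ : ‖x (t + θ)‖ ≤ ‖φ‖ := by
      rw [hx.1 ⟨t + θ, hmem⟩]
      exact φ.norm_coe_le_norm _
    refine h₁.trans (le_mul_of_one_le_left (norm_nonneg _) ?_)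
    rw [mul_assoc, ← Real.exp_add]
    refine one_le_mul_of_one_le_of_one_le hB1 (Real.one_le_exp ?_)
    nlinarith [hθ.1]
end
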